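/- Let c ∈ 𝕋 with c ≠ 0 and let μ be a g-measure for g^c satisfying μ(⟨ω⟩) > 0 for every finite binary word ω. Assume that P̄_top(tψ^c) < ∞ for every t ∈ ℝ. Then the quantity max_{ω∈{0,1}^n} |log μ(⟨ω⟩) − sup_{x∈⟨ω⟩} ψ^c_n(x)| is o(n), i.e. (1/n)·max_{ω∈{0,1}^n} |log μ(⟨ω⟩) − sup_{x∈⟨ω⟩} ψ^c_n(x)| → 0 as n → ∞. -/

import Mathlib

open MeasureTheory Filter Topology Set
open scoped ENNReal

noncomputable section

namespace GTM

abbrev Torus := AddCircle (1 : ℝ)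

instance : Fact ((0:ℝ) < 1) := ⟨one_pos⟩

/-- The doubling map on the torus. -/
def dbl (x : Torus) : Torus := x + x

/-- The function `x ↦ |cos (π x)|` lifted to the torus. -/
def absCos : Torus → ℝ :=
  Function.Periodic.lift (f := fun x : ℝ => |Real.cos (Real.pi * x)|)
    (by
      intro x
      simp [mul_add, mul_one, Real.cos_add_pi, abs_neg])

/-- The potential `ψ^c(x) = 2 log |cos (π (x - c))|`, with value `⊥ = -∞` at the
singularity `c + 1/2`. -/
def psi (c : Torus) (x : Torus) : EReal :=
  if absCos (x - c) = 0 then ⊥ else ((2 * Real.log (absCos (x - c)) : ℝ) : EReal)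

/-- The Birkhoff sums `ψ^c_n` of the potential `ψ^c` under the doubling map. -/
def psiSum (c : Torus) (n : ℕ) (x : Torus) : EReal :=
  ∑ k ∈ Finset.range n, psi c (dbl^[k] x)

/-- The left endpoint of the dyadic cylinder interval of a binary word. -/
def wordVal (n : ℕ) (ω : Fin n → Bool) : ℝ :=
  ∑ i : Fin n, (if ω i then (1 : ℝ) else 0) / 2 ^ ((i : ℕ) + 1)

/-- The closed dyadic interval `⟨ω⟩ ⊆ 𝕋` associated to a binary word `ω`. -/
def cyl (n : ℕ) (ω : Fin n → Bool) : Set Torus :=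
  (fun x : ℝ => (x : Torus)) '' Set.Icc (wordVal n ω) (wordVal n ω + 1 / 2 ^ n)

/-- The exponential function on extended reals, `exp ⊥ = 0`, `exp ⊤ = ∞`. -/
def eexp (x : EReal) : ℝ≥0∞ :=
  if x = ⊥ then 0 else if x = ⊤ then ⊤ else ENNReal.ofReal (Real.exp x.toReal)

/-- The logarithm on `ℝ≥0∞`, `log 0 = ⊥`, `log ∞ = ⊤`. -/
def elog (x : ℝ≥0∞) : EReal :=
  if x = 0 then ⊥ else if x = ⊤ then ⊤ else ((Real.log x.toReal : ℝ) : EReal)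

/-- The partition function `Σ_{ω ∈ {0,1}ⁿ} exp (t · sup_{x ∈ ⟨ω⟩} ψ^c_n(x))`. -/
def presZ (c : Torus) (t : ℝ) (n : ℕ) : ℝ≥0∞ :=
  ∑ ω : Fin n → Bool, eexp ((t : EReal) * ⨆ x ∈ cyl n ω, psiSum c n x)

/-- The upper topological pressure `P̄_top(t ψ^c)`. -/
def presUpper (c : Torus) (t : ℝ) : EReal :=
  atTop.limsup fun n : ℕ => (((n : ℝ)⁻¹ : ℝ) : EReal) * elog (presZ c t n)

/-- The lower topological pressure `P̲_top(t ψ^c)`. -/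
def presLower (c : Torus) (t : ℝ) : EReal :=
  atTop.liminf fun n : ℕ => (((n : ℝ)⁻¹ : ℝ) : EReal) * elog (presZ c t n)

/-- The `g`-function `g^c(x) = cos² (π (x - c))`. -/
def gfun (c : Torus) (x : Torus) : ℝ := (absCos (x - c)) ^ 2

/-- The halving map `x ↦ x/2` on the torus, computed on the representative in `[0,1)`. -/
def half (x : Torus) : Torus := (((AddCircle.equivIco 1 0 x : ℝ) / 2 : ℝ) : Torus)

/-- `μ` is a `g`-measure for `g^c`: it is a Borel probability measure invariant under the
dual transfer operator of `g^c`. -/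
def IsGMeasure (c : Torus) (μ : Measure Torus) : Prop :=
  IsProbabilityMeasure μ ∧
    ∀ f : C(Torus, ℝ),
      ∫ x, f x ∂μ =
        ∫ x,
          (gfun c (half x) * f (half x) +
            gfun c (half x + (((1 : ℝ) / 2 : ℝ) : Torus)) *
              f (half x + (((1 : ℝ) / 2 : ℝ) : Torus))) ∂μ

/-- The representative in `[0,1)` of a point of the torus. -/
def rep (x : Torus) : ℝ := AddCircle.equivIco 1 0 x

lemma rep_mem (x : Torus) : rep x ∈ Ico (0 : ℝ) 1 := by
  have := (AddCircle.equivIco (1 : ℝ) 0 x).2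
  simpa [rep] using this

lemma coe_rep (x : Torus) : ((rep x : ℝ) : Torus) = x := AddCircle.coe_equivIco

lemma rep_coe {y : ℝ} (hy : y ∈ Ico (0 : ℝ) 1) : rep (y : Torus) = y :=
  AddCircle.equivIco_coe_of_mem (by simpa using hy)

lemma measurable_rep : Measurable rep :=
  measurable_subtype_coe.comp (AddCircle.measurableEquivIco (1 : ℝ) 0).measurable

lemma half_eq (x : Torus) : half x = ((rep x / 2 : ℝ) : Torus) := rfl

lemma half_add_eq (x : Torus) :
    half x + (((1 : ℝ) / 2 : ℝ) : Torus) = (((rep x + 1) / 2 : ℝ) : Torus) := by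
  rw [half_eq, ← AddCircle.coe_add]; congr 1; ring

lemma rep_half (x : Torus) : rep (half x) = rep x / 2 := by
  have := rep_mem x
  rw [half_eq, rep_coe]
  constructor <;> linarith [this.1, this.2]

lemma rep_half_add (x : Torus) :
    rep (half x + (((1 : ℝ) / 2 : ℝ) : Torus)) = (rep x + 1) / 2 := by
  have := rep_mem x
  rw [half_add_eq, rep_coe]
  constructor <;> linarith [this.1, this.2]

lemma measurable_half : Measurable half :=
  (AddCircle.measurable_mk' (a := (1 : ℝ))).comp (measurable_rep.div_const 2)

lemma absCos_coe (u : ℝ) : absCos (u : Torus) = |Real.cos (Real.pi * u)| := rfl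

lemma continuous_absCos : Continuous absCos := by
  have : Continuous fun x : ℝ => |Real.cos (Real.pi * x)| := by fun_prop
  exact continuous_quot_lift _ this

lemma absCos_nonneg (x : Torus) : 0 ≤ absCos x := by
  rw [← coe_rep x, absCos_coe]; exact abs_nonneg _

lemma absCos_le_one (x : Torus) : absCos x ≤ 1 := by
  rw [← coe_rep x, absCos_coe]; exact Real.abs_cos_le_one _

lemma continuous_gfun (c : Torus) : Continuous (gfun c) := by
  unfold gfun
  exact (continuous_absCos.comp (continuous_id.sub continuous_const)).pow 2

lemma gfun_nonneg (c x : Torus) : 0 ≤ gfun c x := sq_nonneg _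

lemma gfun_le_one (c x : Torus) : gfun c x ≤ 1 :=
  pow_le_one₀ (absCos_nonneg _) (absCos_le_one _)

lemma integral_map_withDensity_gfun (c : Torus) (μ : Measure Torus)
    {h : Torus → Torus} (hh : Measurable h) (f : C(Torus, ℝ)) :
    ∫ x, f x ∂(μ.withDensity fun x => ENNReal.ofReal (gfun c (h x))).map h =
      ∫ x, gfun c (h x) * f (h x) ∂μ := by
  have hm : Measurable fun x => ENNReal.ofReal (gfun c (h x)) :=
    ((continuous_gfun c).measurable.comp hh).ennreal_ofReal
  rw [integral_map hh.aemeasurable f.continuous.aestronglyMeasurable,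
    integral_withDensity_eq_integral_toReal_smul hm (by simp)]
  simp [ENNReal.toReal_ofReal (gfun_nonneg _ _)]

lemma integrable_gfun_mul (c : Torus) (μ : Measure Torus) [IsFiniteMeasure μ]
    {h : Torus → Torus} (hh : Measurable h) (f : C(Torus, ℝ)) :
    Integrable (fun x => gfun c (h x) * f (h x)) μ := by
  have hc : Continuous fun x => gfun c x * f x := (continuous_gfun c).mul f.continuous
  refine Integrable.of_bound (C := ‖f‖) (hc.measurable.comp hh).aestronglyMeasurable
    (Eventually.of_forall fun x => ?_)
  rw [norm_mul, Real.norm_of_nonneg (gfun_nonneg _ _)]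
  exact (mul_le_of_le_one_left (norm_nonneg _) (gfun_le_one _ _)).trans (f.norm_coe_le_norm _)

lemma isFiniteMeasure_withDensity_gfun (c : Torus) (μ : Measure Torus) [IsFiniteMeasure μ]
    (h : Torus → Torus) :
    IsFiniteMeasure (μ.withDensity fun x => ENNReal.ofReal (gfun c (h x))) := by
  refine isFiniteMeasure_withDensity (ne_of_lt ?_)
  calc ∫⁻ x, ENNReal.ofReal (gfun c (h x)) ∂μ ≤ ∫⁻ _, 1 ∂μ :=
        lintegral_mono fun x => by simpa using gfun_le_one c (h x)
    _ < ⊤ := by simp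

/-- Invariance of a `g`-measure under the dual transfer operator, for nonnegative measurable
functions. -/
lemma IsGMeasure.lintegral_eq {c : Torus} {μ : Measure Torus} (hμ : IsGMeasure c μ)
    {F : Torus → ℝ≥0∞} (hF : Measurable F) :
    ∫⁻ x, F x ∂μ =
      ∫⁻ x, (ENNReal.ofReal (gfun c (half x)) * F (half x) +
        ENNReal.ofReal (gfun c (half x + (((1 : ℝ) / 2 : ℝ) : Torus))) *
          F (half x + (((1 : ℝ) / 2 : ℝ) : Torus))) ∂μ := by
  obtain ⟨hP, hL⟩ := hμ
  have h1 := measurable_half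
  have h2 : Measurable fun x => half x + (((1 : ℝ) / 2 : ℝ) : Torus) := h1.add_const _
  have hg := (continuous_gfun c).measurable
  have i1 := isFiniteMeasure_withDensity_gfun c μ half
  have i2 := isFiniteMeasure_withDensity_gfun c μ fun x => half x + (((1 : ℝ) / 2 : ℝ) : Torus)
  have key : μ = (μ.withDensity fun x => ENNReal.ofReal (gfun c (half x))).map half +
      (μ.withDensity fun x => ENNReal.ofReal
        (gfun c (half x + (((1 : ℝ) / 2 : ℝ) : Torus)))).map
        (fun x => half x + (((1 : ℝ) / 2 : ℝ) : Torus)) := by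
    refine ext_of_forall_integral_eq_of_IsFiniteMeasure fun f => ?_
    have e1 := integral_map_withDensity_gfun c μ h1 f.toContinuousMap
    have e2 := integral_map_withDensity_gfun c μ h2 f.toContinuousMap
    have e := hL f.toContinuousMap
    rw [integral_add (integrable_gfun_mul c μ h1 _) (integrable_gfun_mul c μ h2 _)] at e
    rw [integral_add_measure (f.integrable _) (f.integrable _)]
    exact e.trans (congrArg₂ (· + ·) e1.symm e2.symm)
  conv_lhs => rw [key]
  have w : ∀ {h : Torus → Torus}, Measurable h →
      ∫⁻ x, F (h x) ∂(μ.withDensity fun x => ENNReal.ofReal (gfun c (h x))) =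
        ∫⁻ x, ENNReal.ofReal (gfun c (h x)) * F (h x) ∂μ := fun hh =>
    lintegral_withDensity_eq_lintegral_mul _ (hg.comp hh).ennreal_ofReal (hF.comp hh)
  rw [lintegral_add_measure, lintegral_map hF h1, lintegral_map hF h2, w h1, w h2]
  exact (lintegral_add_left ((hg.comp h1).ennreal_ofReal.mul (hF.comp h1)) _).symm

/-- The function `x ↦ |cos (π (x - b))|` on the real line. -/
def ac (b x : ℝ) : ℝ := |Real.cos (Real.pi * (x - b))|

lemma ac_nonneg (b x : ℝ) : 0 ≤ ac b x := abs_nonneg _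

lemma ac_le_one (b x : ℝ) : ac b x ≤ 1 := Real.abs_cos_le_one _

lemma continuous_ac (b : ℝ) : Continuous (ac b) := by unfold ac; fun_prop

lemma absCos_coe_sub (b x : ℝ) : absCos ((x : Torus) - (b : Torus)) = ac b x := by
  rw [← AddCircle.coe_sub, absCos_coe]; rfl

lemma gfun_coe (b x : ℝ) : gfun (b : Torus) (x : Torus) = ac b x ^ 2 := by
  rw [gfun, absCos_coe_sub]

lemma ac_add_nat (b x : ℝ) (m : ℕ) : ac b (m + x) = ac b x := by
  have : Real.pi * (m + x - b) = Real.pi * (x - b) + m * Real.pi := by ring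
  rw [ac, ac, this, Real.cos_add_nat_mul_pi, abs_mul, abs_pow]
  simp

/-- The product `∏_{k < n} cos² (π (2ᵏ x - b))`. -/
def gprod (b : ℝ) (n : ℕ) (x : ℝ) : ℝ := ∏ k ∈ Finset.range n, ac b (2 ^ k * x) ^ 2

lemma gprod_nonneg (b : ℝ) (n : ℕ) (x : ℝ) : 0 ≤ gprod b n x :=
  Finset.prod_nonneg fun _ _ => sq_nonneg _

lemma continuous_gprod (b : ℝ) (n : ℕ) : Continuous (gprod b n) := by
  unfold gprod
  exact continuous_finsetProd _ fun k _ =>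
    ((continuous_ac b).comp (continuous_const.mul continuous_id)).pow 2

/-- The measure on the line obtained from `μ` by taking representatives in `[0,1)`. -/
def lineMeasure (μ : Measure Torus) : Measure ℝ := μ.map rep

instance (μ : Measure Torus) [IsProbabilityMeasure μ] : IsProbabilityMeasure (lineMeasure μ) :=
  Measure.isProbabilityMeasure_map measurable_rep.aemeasurable

lemma ae_lineMeasure_mem (μ : Measure Torus) : ∀ᵐ y ∂lineMeasure μ, y ∈ Ico (0 : ℝ) 1 :=
  (ae_map_iff measurable_rep.aemeasurable measurableSet_Ico).2 (Eventually.of_forall rep_mem)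

lemma lintegral_lineMeasure {b : ℝ} {μ : Measure Torus} (hμ : IsGMeasure (b : Torus) μ)
    {F : ℝ → ℝ≥0∞} (hF : Measurable F) :
    ∫⁻ y, F y ∂lineMeasure μ =
      ∫⁻ y, (ENNReal.ofReal (ac b (y / 2) ^ 2) * F (y / 2) +
        ENNReal.ofReal (ac b ((y + 1) / 2) ^ 2) * F ((y + 1) / 2)) ∂lineMeasure μ := by
  have hm : Measurable (ac b) := (continuous_ac b).measurable
  rw [lineMeasure, lintegral_map hF measurable_rep, lintegral_map (by fun_prop) measurable_rep]
  refine (hμ.lintegral_eq (hF.comp measurable_rep)).trans ?_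
  refine lintegral_congr fun x => ?_
  simp only [rep_half, rep_half_add, Function.comp]
  rw [half_add_eq, half_eq, gfun_coe, gfun_coe]

/-- The half-open dyadic interval `[j / 2ⁿ, (j + 1) / 2ⁿ)`. -/
def dyad (n : ℕ) (j : ℕ) : Set ℝ := Ico ((j : ℝ) / 2 ^ n) ((j + 1) / 2 ^ n)

lemma mem_dyad_iff {n j : ℕ} {x : ℝ} : x ∈ dyad n j ↔ (j : ℝ) ≤ 2 ^ n * x ∧ 2 ^ n * x < j + 1 := by
  have : (0 : ℝ) < 2 ^ n := by positivity
  rw [dyad, mem_Ico, div_le_iff₀' this, lt_div_iff₀' this]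

lemma measurableSet_dyad (n j : ℕ) : MeasurableSet (dyad n j) := measurableSet_Ico

lemma setLIntegral_dyad {b : ℝ} {μ : Measure Torus} (hμ : IsGMeasure (b : Torus) μ) (n : ℕ) :
    ∀ (j : ℕ), j < 2 ^ n → ∀ (F : ℝ → ℝ≥0∞), Measurable F →
      ∫⁻ y in dyad n j, F y ∂lineMeasure μ =
        ∫⁻ y, ENNReal.ofReal (gprod b n ((j + y) / 2 ^ n)) * F ((j + y) / 2 ^ n)
          ∂lineMeasure μ := by
  induction n with
  | zero =>
    intro j hj F hF
    have : j = 0 := by simpa using hj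
    subst this
    have : ∫⁻ y in dyad 0 0, F y ∂lineMeasure μ = ∫⁻ y, F y ∂lineMeasure μ := by
      rw [← lintegral_indicator (measurableSet_dyad _ _)]
      refine lintegral_congr_ae ?_
      filter_upwards [ae_lineMeasure_mem μ] with y hy
      rw [indicator_of_mem]
      simpa [mem_dyad_iff] using hy
    rw [this]
    simp [gprod]
  | succ n ih =>
    intro j hj F hF
    have hj' : j / 2 < 2 ^ n := by rw [pow_succ] at hj; omega
    have hG : Measurable (gprod b n) := (continuous_gprod b n).measurable
    have hGG : Measurable (gprod b (n + 1)) := (continuous_gprod b (n + 1)).measurable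
    have hac : Measurable (ac b) := (continuous_ac b).measurable
    have hsub : dyad (n + 1) j ⊆ dyad n (j / 2) := by
      intro x hx
      rw [mem_dyad_iff, pow_succ] at hx
      rw [mem_dyad_iff]
      have h1 : ((j / 2 : ℕ) : ℝ) * 2 ≤ j := by exact_mod_cast Nat.div_mul_le_self j 2
      have h2 : (j : ℝ) + 1 ≤ ((j / 2 : ℕ) : ℝ) * 2 + 2 := by
        exact_mod_cast (by omega : j + 1 ≤ j / 2 * 2 + 2)
      constructor <;> nlinarith [hx.1, hx.2]
    have hind := measurableSet_dyad (n + 1) j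
    have hFi : Measurable ((dyad (n + 1) j).indicator F) := hF.indicator hind
    have e0 : ∫⁻ y in dyad (n + 1) j, F y ∂lineMeasure μ =
        ∫⁻ y in dyad n (j / 2), (dyad (n + 1) j).indicator F y ∂lineMeasure μ := by
      rw [setLIntegral_indicator hind, inter_eq_left.2 hsub]
    rw [e0, ih _ hj' _ hFi, lintegral_lineMeasure hμ (by fun_prop)]
    refine lintegral_congr_ae ?_
    filter_upwards [ae_lineMeasure_mem μ] with y hy
    have hp : (0 : ℝ) < 2 ^ n := by positivity
    have hprod : ∀ z : ℝ, gprod b (n + 1) ((((j / 2 : ℕ) : ℝ) + z) / 2 ^ n) =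
        gprod b n ((((j / 2 : ℕ) : ℝ) + z) / 2 ^ n) * ac b z ^ 2 := by
      intro z
      rw [gprod, Finset.prod_range_succ, mul_div_cancel₀ _ hp.ne', ac_add_nat]
      rfl
    have hmem : ∀ z : ℝ, (((j / 2 : ℕ) : ℝ) + z) / 2 ^ n ∈ dyad (n + 1) j ↔
        (j : ℝ) ≤ 2 * (((j / 2 : ℕ) : ℝ) + z) ∧ 2 * (((j / 2 : ℕ) : ℝ) + z) < j + 1 := by
      intro z
      rw [mem_dyad_iff, pow_succ, mul_assoc, mul_left_comm, mul_div_cancel₀ _ hp.ne']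
    rcases Nat.mod_two_eq_zero_or_one j with h | h
    · have hjj : (j : ℝ) = 2 * ((j / 2 : ℕ) : ℝ) := by
        exact_mod_cast (by omega : j = 2 * (j / 2))
      have m1 : (((j / 2 : ℕ) : ℝ) + y / 2) / 2 ^ n ∈ dyad (n + 1) j := by
        rw [hmem]; constructor <;> linarith [hy.1, hy.2]
      have m2 : (((j / 2 : ℕ) : ℝ) + (y + 1) / 2) / 2 ^ n ∉ dyad (n + 1) j := by
        rw [hmem]; intro h; linarith [hy.1, hy.2, h.2]
      have e : ((j : ℝ) + y) / 2 ^ (n + 1) = (((j / 2 : ℕ) : ℝ) + y / 2) / 2 ^ n := by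
        rw [hjj, pow_succ]; field_simp
      rw [indicator_of_mem m1, indicator_of_notMem m2, e, hprod,
        ENNReal.ofReal_mul (gprod_nonneg _ _ _)]
      ring
    · have hjj : (j : ℝ) = 2 * ((j / 2 : ℕ) : ℝ) + 1 := by
        exact_mod_cast (by omega : j = 2 * (j / 2) + 1)
      have m1 : (((j / 2 : ℕ) : ℝ) + y / 2) / 2 ^ n ∉ dyad (n + 1) j := by
        rw [hmem]; intro h; linarith [hy.1, hy.2, h.1]
      have m2 : (((j / 2 : ℕ) : ℝ) + (y + 1) / 2) / 2 ^ n ∈ dyad (n + 1) j := by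
        rw [hmem]; constructor <;> linarith [hy.1, hy.2]
      have e : ((j : ℝ) + y) / 2 ^ (n + 1) = (((j / 2 : ℕ) : ℝ) + (y + 1) / 2) / 2 ^ n := by
        rw [hjj, pow_succ]; field_simp; ring
      rw [indicator_of_notMem m1, indicator_of_mem m2, e, hprod,
        ENNReal.ofReal_mul (gprod_nonneg _ _ _)]
      ring

lemma lineMeasure_dyad {b : ℝ} {μ : Measure Torus} (hμ : IsGMeasure (b : Torus) μ) {n j : ℕ}
    (hj : j < 2 ^ n) :
    lineMeasure μ (dyad n j) =
      ∫⁻ y, ENNReal.ofReal (gprod b n ((j + y) / 2 ^ n)) ∂lineMeasure μ := by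
  have := setLIntegral_dyad hμ n j hj (fun _ => 1) measurable_const
  simpa using this

lemma eq_zero_of_absCos_eq_one {x : Torus} (hx : absCos x = 1) : x = 0 := by
  rw [← coe_rep x] at hx ⊢
  rw [absCos_coe] at hx
  have h1 : Real.cos (Real.pi * rep x) ^ 2 = 1 := by rw [← sq_abs, hx, one_pow]
  have h2 : Real.sin (Real.pi * rep x) = 0 := by
    have := Real.sin_sq_add_cos_sq (Real.pi * rep x)
    rw [h1] at this
    exact pow_eq_zero_iff two_ne_zero |>.1 (by linarith)
  obtain ⟨k, hk⟩ := Real.sin_eq_zero_iff.1 h2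
  have hk' : rep x = k := by
    have := mul_left_cancel₀ Real.pi_ne_zero ((mul_comm _ _).trans hk)
    exact this.symm
  rw [hk']
  exact (AddCircle.coe_eq_zero_iff (1 : ℝ)).2 ⟨k, by simp⟩

/-- If `c ≠ 0`, the product of `g^c` along two consecutive points of an orbit is bounded away
from `1`. -/
lemma exists_mul_ac_sq_le {b : ℝ} (hb : (b : Torus) ≠ 0) :
    ∃ θ : ℝ, 0 < θ ∧ θ < 1 ∧ ∀ x, ac b x ^ 2 * ac b (2 * x) ^ 2 ≤ θ := by
  have hdbl : Continuous dbl := continuous_id.add continuous_id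
  have hcont : Continuous fun x => gfun (b : Torus) x * gfun (b : Torus) (dbl x) :=
    (continuous_gfun _).mul ((continuous_gfun _).comp hdbl)
  obtain ⟨x₀, -, hx₀⟩ := isCompact_univ.exists_isMaxOn ⟨0, mem_univ _⟩ hcont.continuousOn
  have hlt : gfun (b : Torus) x₀ * gfun (b : Torus) (dbl x₀) < 1 := by
    by_contra hge
    have n1 := gfun_nonneg (b : Torus) x₀
    have l1 := gfun_le_one (b : Torus) x₀
    have n2 := gfun_nonneg (b : Torus) (dbl x₀)
    have l2 := gfun_le_one (b : Torus) (dbl x₀)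
    have e1 : gfun (b : Torus) x₀ = 1 := by nlinarith
    have e2 : gfun (b : Torus) (dbl x₀) = 1 := by nlinarith
    have f1 := eq_zero_of_absCos_eq_one
      ((pow_eq_one_iff_of_nonneg (absCos_nonneg _) two_ne_zero).1 e1)
    have f2 := eq_zero_of_absCos_eq_one
      ((pow_eq_one_iff_of_nonneg (absCos_nonneg _) two_ne_zero).1 e2)
    rw [sub_eq_zero] at f1 f2
    rw [dbl, f1] at f2
    exact hb (by simpa using f2)
  refine ⟨max (gfun (b : Torus) x₀ * gfun (b : Torus) (dbl x₀)) (1 / 2),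
    lt_max_of_lt_right (by norm_num), max_lt hlt (by norm_num), fun x => le_max_of_le_left ?_⟩
  have h := hx₀ (mem_univ (x : Torus))
  have e : dbl (x : Torus) = ((2 * x : ℝ) : Torus) := by
    rw [dbl, two_mul, AddCircle.coe_add]
  simpa only [mem_ofPred_eq, e, gfun_coe] using h

lemma gprod_two_mul_le {b θ : ℝ} (hθ : ∀ x, ac b x ^ 2 * ac b (2 * x) ^ 2 ≤ θ)
    (p : ℕ) (x : ℝ) : gprod b (2 * p) x ≤ θ ^ p := by
  induction p with
  | zero => simp [gprod]
  | succ p ih =>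
    have h := hθ (2 ^ (2 * p) * x)
    have e : gprod b (2 * (p + 1)) x = gprod b (2 * p) x *
        (ac b (2 ^ (2 * p) * x) ^ 2 * ac b (2 * (2 ^ (2 * p) * x)) ^ 2) := by
      rw [gprod, show 2 * (p + 1) = 2 * p + 1 + 1 by ring, Finset.prod_range_succ,
        Finset.prod_range_succ, mul_assoc, gprod]
      congr 4
      ring
    rw [e, pow_succ]
    exact mul_le_mul ih h (mul_nonneg (sq_nonneg _) (sq_nonneg _)) ((gprod_nonneg _ _ _).trans ih)

section Regularity

variable {b θ : ℝ} {μ : Measure Torus}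

lemma lineMeasure_dyad_le (hμ : IsGMeasure (b : Torus) μ)
    (hθ : ∀ x, ac b x ^ 2 * ac b (2 * x) ^ 2 ≤ θ) (p j : ℕ) :
    lineMeasure μ (dyad (2 * p) j) ≤ ENNReal.ofReal (θ ^ p) := by
  have := hμ.1
  rcases lt_or_ge j (2 ^ (2 * p)) with hj | hj
  · rw [lineMeasure_dyad hμ hj]
    calc _ ≤ ∫⁻ _, ENNReal.ofReal (θ ^ p) ∂lineMeasure μ :=
          lintegral_mono fun y => ENNReal.ofReal_le_ofReal (gprod_two_mul_le hθ p _)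
      _ = _ := by simp
  · have : lineMeasure μ (dyad (2 * p) j) = 0 := by
      refine measure_mono_null ?_ (ae_lineMeasure_mem μ)
      intro x hx hx'
      have h1 := (mem_dyad_iff.1 hx).1
      have hj' : ((2 : ℝ) ^ (2 * p)) ≤ j := by exact_mod_cast hj
      have : (0 : ℝ) < 2 ^ (2 * p) := by positivity
      nlinarith [hx'.2]
    simp [this]

/-- A `g`-measure gives exponentially small mass to sets of small diameter. -/
lemma lineMeasure_le_of_diam (hμ : IsGMeasure (b : Torus) μ)
    (hθ : ∀ x, ac b x ^ 2 * ac b (2 * x) ^ 2 ≤ θ) (p : ℕ) {A : Set ℝ} (hA : A ⊆ Ico 0 1)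
    (hdiam : ∀ x ∈ A, ∀ y ∈ A, |x - y| < 1 / 2 ^ (2 * p)) :
    lineMeasure μ A ≤ 3 * ENNReal.ofReal (θ ^ p) := by
  rcases A.eq_empty_or_nonempty with rfl | ⟨y₀, hy₀⟩
  · simp
  set N : ℝ := 2 ^ (2 * p) with hN
  have hNpos : 0 < N := by positivity
  have hy₀' := hA hy₀
  set i := ⌊N * y₀⌋₊ with hi
  have hi1 : (i : ℝ) ≤ N * y₀ := Nat.floor_le (mul_nonneg hNpos.le hy₀'.1)
  have hi2 : N * y₀ < i + 1 := Nat.lt_floor_add_one _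
  have hsub : A ⊆ dyad (2 * p) (i - 1) ∪ dyad (2 * p) i ∪ dyad (2 * p) (i + 1) := by
    intro y hy
    have hy' := hA hy
    have hd := hdiam y hy y₀ hy₀
    rw [lt_div_iff₀ hNpos, ← abs_of_pos hNpos, ← abs_mul, abs_lt] at hd
    have hNy : 0 ≤ N * y := mul_nonneg hNpos.le hy'.1
    have hd1 : N * y₀ - 1 < N * y := by linarith [hd.1]
    have hd2 : N * y < N * y₀ + 1 := by linarith [hd.2]
    simp only [mem_union, mem_dyad_iff, ← hN]
    rcases lt_or_ge (N * y) i with h | h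
    · have hi0 : 1 ≤ i := by
        by_contra h0
        have : i = 0 := by omega
        rw [this, Nat.cast_zero] at h
        linarith
      rw [Nat.cast_sub hi0, Nat.cast_one]
      exact Or.inl (Or.inl ⟨by linarith, by linarith⟩)
    · rcases lt_or_ge (N * y) (i + 1) with h' | h'
      · exact Or.inl (Or.inr ⟨h, h'⟩)
      · rw [Nat.cast_add, Nat.cast_one]
        exact Or.inr ⟨h', by linarith⟩
  calc lineMeasure μ A
      ≤ lineMeasure μ (dyad (2 * p) (i - 1)) + lineMeasure μ (dyad (2 * p) i) +
        lineMeasure μ (dyad (2 * p) (i + 1)) :=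
        (measure_mono hsub).trans ((measure_union_le _ _).trans
          (add_le_add_left (measure_union_le _ _) _))
    _ ≤ ENNReal.ofReal (θ ^ p) + ENNReal.ofReal (θ ^ p) + ENNReal.ofReal (θ ^ p) := by
        gcongr <;> exact lineMeasure_dyad_le hμ hθ p _
    _ = _ := by ring

lemma lineMeasure_singleton (hμ : IsGMeasure (b : Torus) μ)
    (hb : (b : Torus) ≠ 0) (x : ℝ) : lineMeasure μ {x} = 0 := by
  obtain ⟨θ, h0, h1, hθ⟩ := exists_mul_ac_sq_le hb
  by_cases hx : x ∈ Ico (0 : ℝ) 1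
  · have hle : ∀ p : ℕ, lineMeasure μ {x} ≤ 3 * ENNReal.ofReal (θ ^ p) := fun p => by
      refine lineMeasure_le_of_diam hμ hθ p (by simpa using hx) ?_
      rintro _ rfl _ rfl
      simp
    have hlim : Tendsto (fun p : ℕ => 3 * ENNReal.ofReal (θ ^ p)) atTop (𝓝 0) := by
      have := ENNReal.tendsto_ofReal (tendsto_pow_atTop_nhds_zero_of_lt_one h0.le h1)
      simpa using ENNReal.Tendsto.const_mul (a := 3) this (Or.inr (by simp))
    exact le_antisymm (ge_of_tendsto' hlim hle) zero_le
  · refine measure_mono_null ?_ (ae_lineMeasure_mem μ)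
    simpa using hx

end Regularity

lemma ac_le_add (b x y : ℝ) : ac b x ≤ ac b y + Real.pi * |x - y| := by
  have h1 := Real.abs_cos_sub_cos_le (Real.pi * (x - b)) (Real.pi * (y - b))
  have h2 := abs_sub_abs_le_abs_sub (Real.cos (Real.pi * (x - b))) (Real.cos (Real.pi * (y - b)))
  have h3 : |Real.pi * (x - b) - Real.pi * (y - b)| = Real.pi * |x - y| := by
    rw [← mul_sub, abs_mul, abs_of_pos Real.pi_pos]; congr 2; ring
  unfold ac
  linarith

/-- Two points at distance at most `1/2` where `|cos (π (x - b))|` is small are close. -/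
lemma abs_sub_lt_of_ac_lt {b x y ε : ℝ} (hxy : |x - y| ≤ 1 / 2) (hx : ac b x < ε)
    (hy : ac b y < ε) : |x - y| < ε := by
  have hpi := Real.pi_pos
  have e : Real.pi * (x - y) = Real.pi * (x - b) - Real.pi * (y - b) := by ring
  have h1 : 2 / Real.pi * |Real.pi * (x - y)| ≤ |Real.sin (Real.pi * (x - y))| := by
    apply Real.mul_abs_le_abs_sin
    rw [abs_mul, abs_of_pos hpi]
    nlinarith
  have h2 : 2 / Real.pi * |Real.pi * (x - y)| = 2 * |x - y| := by
    rw [abs_mul, abs_of_pos hpi]; field_simp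
  have h3 : |Real.sin (Real.pi * (x - y))| ≤ ac b y + ac b x := by
    rw [e, Real.sin_sub]
    refine (abs_sub _ _).trans (add_le_add ?_ ?_)
    · rw [abs_mul]
      exact mul_le_of_le_one_left (abs_nonneg _) (Real.abs_sin_le_one _)
    · rw [abs_mul]
      exact mul_le_of_le_one_right (abs_nonneg _) (Real.abs_sin_le_one _)
  linarith

lemma log_sub_log_le {a a' h δ Λ ρ κ : ℝ} (hh : 0 < h) (ha : 0 < a) (ha' : 0 < a') (ha_one : a' ≤ 1)
    (hlip : a' ≤ a + Real.pi * h) (hδ : 0 < δ) (hδa : h * δ ≤ a)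
    (hΛ : Real.log (1 + Real.pi / δ) ≤ Λ) (hρ : 0 < ρ) (hρ1 : ρ ≤ 1) (hκ : 0 < κ)
    (hρκ : 5 * ρ ≤ Real.exp (-κ)) :
    Real.log a' - Real.log a ≤
      Real.pi * ρ + (if ρ ^ 2 < h then Λ else 0) + Λ * (-Real.log a') / κ := by
  have hpi := Real.pi_pos
  have hpi4 := Real.pi_le_four
  have hΛ0 : 0 ≤ Λ := (Real.log_nonneg (by linarith [div_pos hpi hδ])).trans hΛ
  have hla : 0 ≤ -Real.log a' := by linarith [Real.log_nonpos ha'.le ha_one]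
  have hthird : 0 ≤ Λ * (-Real.log a') / κ := by positivity
  have hfirst : 0 ≤ Real.pi * ρ := by positivity
  have hratio : a' ≤ a * (1 + Real.pi * h / a) := by
    rw [mul_add, mul_one, mul_div_cancel₀ _ ha.ne']; exact hlip
  have hlog : Real.log a' - Real.log a ≤ Real.log (1 + Real.pi * h / a) := by
    have := Real.log_le_log ha' hratio
    rw [Real.log_mul ha.ne' (by positivity)] at this
    linarith
  have hcrude : Real.log a' - Real.log a ≤ Λ := by
    refine hlog.trans ((Real.log_le_log (by positivity) ?_).trans hΛ)
    gcongr 1 + ?_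
    rw [div_le_div_iff₀ ha hδ]
    nlinarith
  split_ifs with hcase
  · linarith
  · push Not at hcase
    rcases le_or_gt ρ a with hgood | hbad
    · have h1 : Real.log (1 + Real.pi * h / a) ≤ Real.pi * h / a := by
        have := Real.log_le_sub_one_of_pos (show 0 < 1 + Real.pi * h / a by positivity)
        linarith
      have h2 : Real.pi * h / a ≤ Real.pi * ρ := by
        rw [div_le_iff₀ ha]
        have : h ≤ ρ * a := hcase.trans (by nlinarith)
        nlinarith
      linarith
    · have h1 : a' ≤ Real.exp (-κ) := by
        refine le_trans ?_ hρκ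
        nlinarith
      have h2 : κ ≤ -Real.log a' := by
        have := Real.log_le_log ha' h1
        rw [Real.log_exp] at this
        linarith
      have h3 : Λ ≤ Λ * (-Real.log a') / κ := by
        rw [le_div_iff₀ hκ]
        nlinarith
      linarith

lemma gprod_succ (b : ℝ) (n : ℕ) (x : ℝ) :
    gprod b (n + 1) x = gprod b n x * ac b (2 ^ n * x) ^ 2 :=
  Finset.prod_range_succ _ _

lemma log_gprod {b x : ℝ} {n : ℕ} (hx : ∀ k < n, 0 < ac b (2 ^ k * x)) :
    Real.log (gprod b n x) = 2 * ∑ k ∈ Finset.range n, Real.log (ac b (2 ^ k * x)) := by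
  rw [gprod, Real.log_prod fun k hk => (pow_pos (hx k (Finset.mem_range.1 hk)) 2).ne',
    Finset.mul_sum]
  simp

lemma sum_ite_dyadic_le {Λ : ℝ} (hΛ : 0 ≤ Λ) (n r : ℕ) :
    ∑ k ∈ Finset.range n, (if ((1 : ℝ) / 2 ^ r) ^ 2 < 2 ^ k / 2 ^ n then Λ else 0) ≤
      2 * r * Λ := by
  rw [← Finset.sum_filter, Finset.sum_const, nsmul_eq_mul]
  refine mul_le_mul_of_nonneg_right ?_ hΛ
  have hsub : (Finset.range n).filter (fun k => ((1 : ℝ) / 2 ^ r) ^ 2 < 2 ^ k / 2 ^ n) ⊆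
      Finset.Ico (n - 2 * r) n := by
    intro k hk
    rw [Finset.mem_filter, Finset.mem_range, div_pow, one_pow, ← pow_mul,
      div_lt_div_iff₀ (by positivity) (by positivity), one_mul, ← pow_add] at hk
    have := (pow_lt_pow_iff_right₀ (one_lt_two (α := ℝ))).1 hk.2
    rw [Finset.mem_Ico]
    omega
  have h := Finset.card_le_card hsub
  rw [Nat.card_Ico] at h
  have h' := h.trans (by omega : n - (n - 2 * r) ≤ 2 * r)
  exact_mod_cast h'

/-- Distortion of `gprod` between two points of the same dyadic interval, the second of which stays
away from the singularities. -/
lemma log_gprod_sub_le {b x x' δ Λ κ : ℝ} {n r : ℕ} (hxx : |x' - x| ≤ 1 / 2 ^ n)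
    (hx' : 0 < gprod b n x') (hδ : 0 < δ) (hx : ∀ k < n, 2 ^ k / 2 ^ n * δ ≤ ac b (2 ^ k * x))
    (hΛ : Real.log (1 + Real.pi / δ) ≤ Λ) (hκ : 0 < κ)
    (hrκ : 5 * ((1 : ℝ) / 2 ^ r) ≤ Real.exp (-κ)) :
    Real.log (gprod b n x') - Real.log (gprod b n x) ≤
      2 * (n * (Real.pi * (1 / 2 ^ r)) + 2 * r * Λ) + Λ * (-Real.log (gprod b n x')) / κ := by
  have hΛ0 : 0 ≤ Λ :=
    (Real.log_nonneg (by linarith [div_pos Real.pi_pos hδ])).trans hΛ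
  have ha : ∀ k < n, 0 < ac b (2 ^ k * x) := fun k hk =>
    lt_of_lt_of_le (by positivity) (hx k hk)
  have ha' : ∀ k < n, 0 < ac b (2 ^ k * x') := by
    intro k hk
    refine (ac_nonneg _ _).lt_of_ne fun h0 => hx'.ne' ?_
    exact Finset.prod_eq_zero (Finset.mem_range.2 hk) (by rw [← h0]; simp)
  have hterm : ∀ k ∈ Finset.range n,
      Real.log (ac b (2 ^ k * x')) - Real.log (ac b (2 ^ k * x)) ≤
        Real.pi * (1 / 2 ^ r) + (if ((1 : ℝ) / 2 ^ r) ^ 2 < 2 ^ k / 2 ^ n then Λ else 0) +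
          Λ * (-Real.log (ac b (2 ^ k * x'))) / κ := by
    intro k hk
    rw [Finset.mem_range] at hk
    refine log_sub_log_le (by positivity) (ha k hk) (ha' k hk) (ac_le_one _ _) ?_ hδ (hx k hk) hΛ
      (by positivity) ?_ hκ hrκ
    · refine (ac_le_add b _ (2 ^ k * x)).trans ?_
      rw [← mul_sub, abs_mul, abs_of_pos (by positivity : (0 : ℝ) < 2 ^ k), div_eq_mul_one_div]
      gcongr
    · rw [div_le_one (by positivity)]
      exact one_le_pow₀ one_le_two
  have hsum := Finset.sum_le_sum hterm
  rw [Finset.sum_sub_distrib, Finset.sum_add_distrib, Finset.sum_add_distrib, Finset.sum_const,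
    Finset.card_range, nsmul_eq_mul, ← Finset.sum_div, ← Finset.mul_sum,
    Finset.sum_neg_distrib] at hsum
  rw [log_gprod ha, log_gprod ha']
  have hite := sum_ite_dyadic_le hΛ0 n r
  have e : Λ * -(2 * ∑ k ∈ Finset.range n, Real.log (ac b (2 ^ k * x'))) / κ =
      2 * (Λ * -(∑ k ∈ Finset.range n, Real.log (ac b (2 ^ k * x'))) / κ) := by ring
  rw [e]
  linarith

/-- The points `y ∈ [0,1)` such that the first `n` iterates of `(j + y) / 2ⁿ` keep a distance of
order `δ` from the singularity, relative to the length of the corresponding dyadic interval. -/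
def awaySet (b : ℝ) (n j : ℕ) (δ : ℝ) : Set ℝ :=
  {y | y ∈ Ico (0 : ℝ) 1 ∧ ∀ k < n, 2 ^ k / 2 ^ n * δ ≤ ac b (2 ^ k * ((j + y) / 2 ^ n))}

lemma measurableSet_awaySet (b : ℝ) (n j : ℕ) (δ : ℝ) : MeasurableSet (awaySet b n j δ) := by
  have hac : Continuous (ac b) := continuous_ac b
  have : awaySet b n j δ = Ico (0 : ℝ) 1 ∩
      ⋂ k ∈ Finset.range n, {y | 2 ^ k / 2 ^ n * δ ≤ ac b (2 ^ k * ((j + y) / 2 ^ n))} := by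
    ext y; simp [awaySet]
  rw [this]
  refine measurableSet_Ico.inter (Finset.measurableSet_biInter _ fun k _ => ?_)
  exact (isClosed_le continuous_const (by fun_prop)).measurableSet

section LowerBound

variable {b θ : ℝ} {μ : Measure Torus}

lemma half_le_lineMeasure_awaySet (hμ : IsGMeasure (b : Torus) μ)
    (hθ : ∀ x, ac b x ^ 2 * ac b (2 * x) ^ 2 ≤ θ) {n p : ℕ} (j : ℕ)
    (hn : n * (3 * θ ^ p) ≤ 1 / 2) :
    ENNReal.ofReal (1 / 2) ≤ lineMeasure μ (awaySet b n j (1 / 2 ^ (2 * p))) := by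
  have := hμ.1
  set δ : ℝ := 1 / 2 ^ (2 * p) with hδ
  have hθ0 : 0 ≤ θ := le_trans (mul_nonneg (sq_nonneg _) (sq_nonneg _)) (hθ 0)
  let B : ℕ → Set ℝ := fun k =>
    {y | y ∈ Ico (0 : ℝ) 1 ∧ ac b (2 ^ k * ((j + y) / 2 ^ n)) < 2 ^ k / 2 ^ n * δ}
  have hB : ∀ k ∈ Finset.range n, lineMeasure μ (B k) ≤ 3 * ENNReal.ofReal (θ ^ p) := by
    intro k hk
    have hk' : k + 1 ≤ n := Finset.mem_range.1 hk
    refine lineMeasure_le_of_diam hμ hθ p (fun y hy => hy.1) ?_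
    intro x hx y hy
    have hh : (0 : ℝ) < 2 ^ k / 2 ^ n := by positivity
    have hh2 : (2 : ℝ) ^ k / 2 ^ n ≤ 1 / 2 := by
      rw [div_le_div_iff₀ (by positivity) two_pos, one_mul, ← pow_succ]
      exact pow_le_pow_right₀ one_le_two hk'
    have e : |2 ^ k * ((j + x) / 2 ^ n) - 2 ^ k * ((j + y) / 2 ^ n)| =
        2 ^ k / 2 ^ n * |x - y| := by
      rw [show 2 ^ k * ((j + x) / 2 ^ n) - 2 ^ k * ((j + y) / 2 ^ n) =
        (2 : ℝ) ^ k / 2 ^ n * (x - y) by ring, abs_mul, abs_of_pos hh]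
    have hxy : |x - y| ≤ 1 := by
      rw [abs_le]; constructor <;> linarith [hx.1.1, hx.1.2, hy.1.1, hy.1.2]
    have h := abs_sub_lt_of_ac_lt (by rw [e]; nlinarith [abs_nonneg (x - y)]) hx.2 hy.2
    rw [e] at h
    exact lt_of_mul_lt_mul_left h hh.le
  have hcov : Ico (0 : ℝ) 1 ⊆ awaySet b n j δ ∪ ⋃ k ∈ Finset.range n, B k := by
    intro y hy
    by_cases hy' : ∀ k < n, 2 ^ k / 2 ^ n * δ ≤ ac b (2 ^ k * ((j + y) / 2 ^ n))
    · exact Or.inl ⟨hy, hy'⟩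
    · push Not at hy'
      obtain ⟨k, hk, hk'⟩ := hy'
      exact Or.inr (mem_biUnion (Finset.mem_coe.2 (Finset.mem_range.2 hk)) ⟨hy, hk'⟩)
  have hone : lineMeasure μ (Ico 0 1) = 1 := by
    rw [← measure_univ (μ := lineMeasure μ)]
    refine measure_congr ?_
    filter_upwards [ae_lineMeasure_mem μ] with y hy
    exact propext ⟨fun _ => trivial, fun _ => hy⟩
  have hbad : lineMeasure μ (⋃ k ∈ Finset.range n, B k) ≤ ENNReal.ofReal (1 / 2) := by
    calc _ ≤ ∑ k ∈ Finset.range n, lineMeasure μ (B k) := measure_biUnion_finset_le _ _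
      _ ≤ ∑ k ∈ Finset.range n, 3 * ENNReal.ofReal (θ ^ p) := Finset.sum_le_sum hB
      _ = ENNReal.ofReal (n * (3 * θ ^ p)) := by
        rw [Finset.sum_const, Finset.card_range, nsmul_eq_mul, ENNReal.ofReal_mul (by positivity),
          ENNReal.ofReal_mul (by positivity)]
        simp
      _ ≤ _ := ENNReal.ofReal_le_ofReal hn
  have htot : ENNReal.ofReal (1 / 2) + ENNReal.ofReal (1 / 2) ≤
      lineMeasure μ (awaySet b n j δ) + ENNReal.ofReal (1 / 2) := by
    rw [← ENNReal.ofReal_add (by norm_num) (by norm_num), add_halves, ENNReal.ofReal_one, ← hone]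
    exact (measure_mono hcov).trans ((measure_union_le _ _).trans (by gcongr))
  exact (ENNReal.add_le_add_iff_right ENNReal.ofReal_ne_top).1 htot

lemma le_log_lineMeasure_dyad (hμ : IsGMeasure (b : Torus) μ)
    (hθ : ∀ x, ac b x ^ 2 * ac b (2 * x) ^ 2 ≤ θ) {n p r j : ℕ} (hj : j < 2 ^ n)
    (hn : n * (3 * θ ^ p) ≤ 1 / 2) {x' Λ κ : ℝ}
    (hx_mem : x' ∈ Icc ((j : ℝ) / 2 ^ n) ((j + 1) / 2 ^ n)) (hx' : 0 < gprod b n x')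
    (hΛ : Real.log (1 + Real.pi * 2 ^ (2 * p)) ≤ Λ) (hκ : 0 < κ)
    (hrκ : 5 * ((1 : ℝ) / 2 ^ r) ≤ Real.exp (-κ)) :
    Real.log (gprod b n x') - (2 * (n * (Real.pi * (1 / 2 ^ r)) + 2 * r * Λ) +
      Λ * (-Real.log (gprod b n x')) / κ) - Real.log 2 ≤
      Real.log (lineMeasure μ (dyad n j)).toReal := by
  have := hμ.1
  set L := 2 * (n * (Real.pi * (1 / 2 ^ r)) + 2 * r * Λ) +
      Λ * (-Real.log (gprod b n x')) / κ with hL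
  set δ : ℝ := 1 / 2 ^ (2 * p) with hδ
  have hpt : ∀ y ∈ awaySet b n j δ,
      Real.exp (Real.log (gprod b n x') - L) ≤ gprod b n ((j + y) / 2 ^ n) := by
    intro y hy
    have hN : (0 : ℝ) < 2 ^ n := by positivity
    have hδ0 : 0 < δ := by positivity
    have hd : |x' - (j + y) / 2 ^ n| ≤ 1 / 2 ^ n := by
      have h1 := hx_mem.1
      have h2 := hx_mem.2
      rw [add_div] at h2 ⊢
      have h3 : 0 ≤ y / 2 ^ n := div_nonneg hy.1.1 hN.le
      have h4 : y / 2 ^ n ≤ 1 / 2 ^ n := by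
        gcongr
        exact hy.1.2.le
      rw [abs_le]; constructor <;> linarith
    have hΛδ : Real.log (1 + Real.pi / δ) ≤ Λ := by
      rwa [hδ, div_div_eq_mul_div, div_one]
    have h := log_gprod_sub_le (r := r) hd hx' hδ0 hy.2 hΛδ hκ hrκ
    have hpos : 0 < gprod b n ((j + y) / 2 ^ n) :=
      Finset.prod_pos fun k hk => pow_pos
        (lt_of_lt_of_le (by positivity) (hy.2 k (Finset.mem_range.1 hk))) 2
    rw [← Real.le_log_iff_exp_le hpos]
    linarith
  have hlow : ENNReal.ofReal (Real.exp (Real.log (gprod b n x') - L) * (1 / 2)) ≤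
      lineMeasure μ (dyad n j) := by
    rw [lineMeasure_dyad hμ hj, ENNReal.ofReal_mul (Real.exp_pos _).le]
    calc _ ≤ ENNReal.ofReal (Real.exp (Real.log (gprod b n x') - L)) *
          lineMeasure μ (awaySet b n j δ) := by
          gcongr
          exact half_le_lineMeasure_awaySet hμ hθ j hn
      _ = ∫⁻ _ in awaySet b n j δ,
          ENNReal.ofReal (Real.exp (Real.log (gprod b n x') - L)) ∂lineMeasure μ := by simp
      _ ≤ ∫⁻ y in awaySet b n j δ, ENNReal.ofReal (gprod b n ((j + y) / 2 ^ n))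
          ∂lineMeasure μ :=
          setLIntegral_mono' (measurableSet_awaySet _ _ _ _) fun y hy =>
            ENNReal.ofReal_le_ofReal (hpt y hy)
      _ ≤ _ := setLIntegral_le_lintegral _ _
  have hreal := (ENNReal.ofReal_le_iff_le_toReal (measure_ne_top _ _)).1 hlow
  have hlog := Real.log_le_log (by positivity) hreal
  rw [Real.log_mul (Real.exp_pos _).ne' (by norm_num), Real.log_exp, one_div, Real.log_inv] at hlog
  linarith

lemma lineMeasure_dyad_le_of_gprod_le (hμ : IsGMeasure (b : Torus) μ) {n j : ℕ} (hj : j < 2 ^ n)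
    {M : ℝ} (hM : ∀ x ∈ Icc ((j : ℝ) / 2 ^ n) ((j + 1) / 2 ^ n), gprod b n x ≤ M) :
    lineMeasure μ (dyad n j) ≤ ENNReal.ofReal M := by
  have := hμ.1
  rw [lineMeasure_dyad hμ hj]
  calc _ ≤ ∫⁻ _, ENNReal.ofReal M ∂lineMeasure μ := by
        refine lintegral_mono_ae ?_
        filter_upwards [ae_lineMeasure_mem μ] with y hy
        refine ENNReal.ofReal_le_ofReal (hM _ ⟨?_, ?_⟩)
        · gcongr; linarith [hy.1]
        · gcongr; exact hy.2.le
    _ = _ := by simp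

end LowerBound

lemma exists_wordVal_eq (n : ℕ) (ω : Fin n → Bool) :
    ∃ j : ℕ, j < 2 ^ n ∧ wordVal n ω = (j : ℝ) / 2 ^ n := by
  induction n with
  | zero => exact ⟨0, by simp, by simp [wordVal]⟩
  | succ n ih =>
    obtain ⟨j, hj, e⟩ := ih fun i => ω i.castSucc
    refine ⟨2 * j + if ω (Fin.last n) then 1 else 0, ?_, ?_⟩
    · rw [pow_succ]; split_ifs <;> omega
    · have : wordVal (n + 1) ω = wordVal n (fun i => ω i.castSucc) +
          (if ω (Fin.last n) then (1 : ℝ) else 0) / 2 ^ (n + 1) := by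
        simp only [wordVal, Fin.sum_univ_castSucc, Fin.val_castSucc, Fin.val_last]
      rw [this, e]
      push_cast
      field_simp
      ring

lemma iterate_dbl_coe (k : ℕ) (x : ℝ) : dbl^[k] (x : Torus) = ((2 ^ k * x : ℝ) : Torus) := by
  induction k with
  | zero => simp
  | succ k ih =>
    rw [Function.iterate_succ_apply', ih, dbl, ← AddCircle.coe_add]
    congr 1; ring

lemma psiSum_coe (b : ℝ) (n : ℕ) (x : ℝ) :
    psiSum (b : Torus) n (x : Torus) =
      if gprod b n x = 0 then ⊥ else ((Real.log (gprod b n x) : ℝ) : EReal) := by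
  induction n with
  | zero => simp [psiSum, gprod]
  | succ n ih =>
    rw [psiSum, Finset.sum_range_succ, ← psiSum, ih, psi, iterate_dbl_coe, absCos_coe_sub,
      gprod_succ]
    by_cases h1 : gprod b n x = 0
    · simp [h1]
    · by_cases h2 : ac b (2 ^ n * x) = 0
      · simp [h2]
      · rw [if_neg h1, if_neg h2, if_neg (mul_ne_zero h1 (pow_ne_zero 2 h2)),
          Real.log_mul h1 (pow_ne_zero 2 h2), Real.log_pow, EReal.coe_add]
        simp

lemma iSup_psiSum_eq {b : ℝ} {n j : ℕ} {ω : Fin n → Bool} (hω : wordVal n ω = (j : ℝ) / 2 ^ n)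
    {x' : ℝ} (hx_mem : x' ∈ Icc ((j : ℝ) / 2 ^ n) ((j + 1) / 2 ^ n)) (hx' : 0 < gprod b n x')
    (hmax : ∀ x ∈ Icc ((j : ℝ) / 2 ^ n) ((j + 1) / 2 ^ n), gprod b n x ≤ gprod b n x') :
    ⨆ x ∈ cyl n ω, psiSum (b : Torus) n x = ((Real.log (gprod b n x') : ℝ) : EReal) := by
  rw [cyl, hω, ← add_div]
  apply le_antisymm
  · refine iSup₂_le ?_
    rintro _ ⟨x, hx, rfl⟩
    rw [psiSum_coe]
    split_ifs with h
    · exact bot_le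
    · exact EReal.coe_le_coe_iff.2
        (Real.log_le_log ((gprod_nonneg b n x).lt_of_ne' h) (hmax x hx))
  · refine le_iSup₂_of_le (x' : Torus) ⟨x', hx_mem, rfl⟩ ?_
    rw [psiSum_coe, if_neg hx'.ne']

lemma measure_cyl_eq {b : ℝ} (hb : (b : Torus) ≠ 0) {μ : Measure Torus}
    (hμ : IsGMeasure (b : Torus) μ) {n j : ℕ} {ω : Fin n → Bool} (hj : j < 2 ^ n)
    (hω : wordVal n ω = (j : ℝ) / 2 ^ n) : μ (cyl n ω) = lineMeasure μ (dyad n j) := by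
  have hmeas : MeasurableSet (cyl n ω) :=
    (isCompact_Icc.image (AddCircle.continuous_mk' (1 : ℝ))).isClosed.measurableSet
  have hN : (0 : ℝ) < 2 ^ n := by positivity
  have hj' : (j : ℝ) + 1 ≤ 2 ^ n := by exact_mod_cast hj
  have hlow : (0 : ℝ) ≤ j / 2 ^ n := by positivity
  have hup : ((j : ℝ) + 1) / 2 ^ n ≤ 1 := (div_le_one hN).2 hj'
  have e : μ (cyl n ω) = μ (rep ⁻¹' dyad n j) := by
    apply le_antisymm
    · have hnull : ∀ x : ℝ, μ (rep ⁻¹' {x}) = 0 := fun x => by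
        rw [← Measure.map_apply measurable_rep (measurableSet_singleton x)]
        exact lineMeasure_singleton hμ hb x
      have hsub : cyl n ω ⊆
          rep ⁻¹' dyad n j ∪ (rep ⁻¹' {((j : ℝ) + 1) / 2 ^ n} ∪ rep ⁻¹' {0}) := by
        rintro _ ⟨x, hx, rfl⟩
        rw [hω, ← add_div] at hx
        rcases lt_or_ge x 1 with h1 | h1
        · have hr : rep (x : Torus) = x := rep_coe ⟨hlow.trans hx.1, h1⟩
          rcases hx.2.lt_or_eq with h2 | h2
          · left; rw [mem_preimage, hr]; exact ⟨hx.1, h2⟩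
          · right; left; rw [mem_preimage, hr]; exact h2
        · right; right
          have hx1 : x = 1 := le_antisymm (hx.2.trans hup) h1
          have h0 : ((1 : ℝ) : Torus) = ((0 : ℝ) : Torus) := by
            rw [AddCircle.coe_period]; rfl
          change rep (x : Torus) = 0
          rw [hx1, h0, rep_coe ⟨le_rfl, one_pos⟩]
      calc μ (cyl n ω) ≤ μ (rep ⁻¹' dyad n j) +
            (μ (rep ⁻¹' {((j : ℝ) + 1) / 2 ^ n}) + μ (rep ⁻¹' {0})) :=
            (measure_mono hsub).trans ((measure_union_le _ _).trans
              (by gcongr; exact measure_union_le _ _))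
        _ = _ := by rw [hnull, hnull, add_zero, add_zero]
    · refine measure_mono fun x hx => ?_
      refine ⟨rep x, ?_, coe_rep x⟩
      rw [hω, ← add_div]
      exact Ico_subset_Icc_self hx
  rw [e, lineMeasure, Measure.map_apply measurable_rep (measurableSet_dyad n j)]

lemma exists_presZ_le_exp {c : Torus} {t : ℝ} (h : presUpper c t ≠ ⊤) :
    ∃ C : ℝ, 0 ≤ C ∧ ∀ᶠ n : ℕ in atTop, presZ c t n ≤ ENNReal.ofReal (Real.exp (C * n)) := by
  obtain ⟨C, hC, -⟩ := EReal.lt_iff_exists_real_btwn.1 (lt_top_iff_ne_top.2 h)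
  refine ⟨max C 0, le_max_right _ _, ?_⟩
  filter_upwards [eventually_lt_of_limsup_lt hC, eventually_gt_atTop 0] with n hn hn0
  have hn0' : (0 : ℝ) < n := by exact_mod_cast hn0
  rw [elog] at hn
  split_ifs at hn with h0 htop
  · rw [h0]; exact zero_le
  · rw [EReal.coe_mul_top_of_pos (inv_pos.2 hn0')] at hn
    exact absurd hn not_top_lt
  · rw [← EReal.coe_mul, EReal.coe_lt_coe_iff, inv_mul_lt_iff₀ hn0'] at hn
    rw [ENNReal.le_ofReal_iff_toReal_le htop (Real.exp_pos _).le,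
      ← Real.log_le_iff_le_exp (ENNReal.toReal_pos h0 htop)]
    nlinarith [le_max_left C 0]

/-- A finite pressure at `t = -1` bounds the suprema of the Birkhoff sums from below. -/
lemma neg_log_le_of_presZ_le {c : Torus} {n : ℕ} {ω : Fin n → Bool} {C a : ℝ}
    (hZ : presZ c (-1) n ≤ ENNReal.ofReal (Real.exp (C * n)))
    (ha : ⨆ x ∈ cyl n ω, psiSum c n x = (a : EReal)) : -a ≤ C * n := by
  have h1 : eexp (((-1 : ℝ) : EReal) * ⨆ x ∈ cyl n ω, psiSum c n x) ≤ presZ c (-1) n :=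
    Finset.single_le_sum (f := fun ω : Fin n → Bool =>
      eexp (((-1 : ℝ) : EReal) * ⨆ x ∈ cyl n ω, psiSum c n x)) (fun _ _ => zero_le)
      (Finset.mem_univ ω)
  rw [ha, ← EReal.coe_mul, eexp, if_neg (EReal.coe_ne_bot _), if_neg (EReal.coe_ne_top _),
    EReal.toReal_coe, neg_one_mul] at h1
  have h2 := (ENNReal.ofReal_le_ofReal_iff (Real.exp_pos _).le).1 (h1.trans hZ)
  exact Real.exp_le_exp.1 h2

lemma log_one_add_pi_mul_le (s : ℕ) :
    Real.log (1 + Real.pi * 2 ^ (2 * s)) ≤ 2 * s + 3 := by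
  have hp : (1 : ℝ) ≤ 2 ^ (2 * s) := one_le_pow₀ one_le_two
  have h1 : 1 + Real.pi * 2 ^ (2 * s) ≤ (2 : ℝ) ^ (2 * s + 3) := by
    rw [pow_add]; nlinarith [Real.pi_le_four]
  have h2 := Real.log_le_log (by positivity) h1
  rw [Real.log_pow] at h2
  push_cast at h2
  have : Real.log 2 ≤ 1 := by linarith [Real.log_two_lt_d9]
  nlinarith [(Nat.cast_nonneg s : (0 : ℝ) ≤ s)]

lemma five_mul_le_exp {r : ℕ} (hr : 3 ≤ r) :
    5 * ((1 : ℝ) / 2 ^ r) ≤ Real.exp (-(((r : ℝ) - 3) / 2)) := by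
  obtain ⟨q, rfl⟩ := Nat.exists_eq_add_of_le hr
  have h1 : Real.exp (-(q * Real.log 2)) = 1 / 2 ^ q := by
    rw [Real.exp_neg, Real.exp_nat_mul, Real.exp_log two_pos, one_div]
  have h2 : (1 : ℝ) / 2 ^ q ≤ Real.exp (-((((3 + q : ℕ) : ℝ) - 3) / 2)) := by
    rw [← h1]
    apply Real.exp_le_exp.2
    have : (1 : ℝ) / 2 ≤ Real.log 2 := by linarith [Real.log_two_gt_d9]
    push_cast
    nlinarith [(Nat.cast_nonneg q : (0 : ℝ) ≤ q)]
  refine le_trans ?_ h2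
  rw [pow_add, mul_one_div, div_le_div_iff₀ (by positivity) (by positivity)]
  have : (0 : ℝ) < 2 ^ q := by positivity
  linarith

lemma error_le {n s : ℕ} {C : ℝ} (hC : 0 ≤ C) (hs : 3 ≤ s) (hn : s ^ 4 ≤ n) :
    2 * (n * (Real.pi * (1 / 2 ^ (s ^ 2))) + 2 * ((s ^ 2 : ℕ) : ℝ) * (2 * s + 3)) +
      (2 * s + 3) * (C * n) / ((((s ^ 2 : ℕ) : ℝ) - 3) / 2) + Real.log 2 ≤
      n * ((21 + 12 * C) / s) := by
  have hs' : (3 : ℝ) ≤ s := by exact_mod_cast hs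
  have hs0 : (0 : ℝ) < s := by linarith
  have hn' : (s : ℝ) ^ 4 ≤ n := by exact_mod_cast hn
  have hn0 : (0 : ℝ) ≤ n := Nat.cast_nonneg n
  have hpow : (s : ℝ) ≤ 2 ^ (s ^ 2) := by
    have : s ≤ 2 ^ (s ^ 2) :=
      (Nat.le_self_pow two_ne_zero s).trans (Nat.lt_two_pow_self).le
    exact_mod_cast this
  have h1 : 2 * (n * (Real.pi * (1 / 2 ^ (s ^ 2)))) ≤ n * (8 / s) := by
    have : Real.pi * (1 / 2 ^ (s ^ 2)) ≤ 4 * (1 / s) := by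
      gcongr
      exact Real.pi_le_four
    calc _ ≤ 2 * (n * (4 * (1 / (s : ℝ)))) := by gcongr
      _ = _ := by ring
  have h2 : 2 * (2 * ((s ^ 2 : ℕ) : ℝ) * (2 * s + 3)) ≤ n * (12 / s) := by
    rw [← mul_div_assoc, le_div_iff₀ hs0]
    push_cast
    nlinarith [pow_pos hs0 3]
  have h3 : (2 * s + 3) * (C * n) / ((((s ^ 2 : ℕ) : ℝ) - 3) / 2) ≤ n * (12 * C / s) := by
    push_cast
    have hq : (0 : ℝ) < ((s : ℝ) ^ 2 - 3) / 2 := by nlinarith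
    have : (2 * s + 3) / (((s : ℝ) ^ 2 - 3) / 2) ≤ 12 / s := by
      rw [div_le_div_iff₀ hq hs0]
      nlinarith
    calc _ = C * n * ((2 * s + 3) / (((s : ℝ) ^ 2 - 3) / 2)) := by ring
      _ ≤ C * n * (12 / s) := by gcongr
      _ = _ := by ring
  have h4 : Real.log 2 ≤ n * (1 / s) := by
    rw [mul_one_div, le_div_iff₀ hs0]
    have hl : Real.log 2 ≤ 1 := by linarith [Real.log_two_lt_d9]
    have : (s : ℝ) ≤ s ^ 4 := le_self_pow₀ (by linarith) (by norm_num)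
    nlinarith
  have e : n * ((21 + 12 * C) / s) =
      n * (8 / s) + n * (12 / s) + n * (12 * C / s) + n * (1 / (s : ℝ)) := by ring
  rw [e]
  linarith

lemma tendsto_sqrt_sqrt : Tendsto (fun n : ℕ => Nat.sqrt (Nat.sqrt n)) atTop atTop := by
  have : Tendsto Nat.sqrt atTop atTop :=
    tendsto_atTop.2 fun m => by
      filter_upwards [eventually_ge_atTop (m * m)] with n hn using Nat.le_sqrt.2 hn
  exact this.comp this

lemma sqrt_sqrt_pow_le (n : ℕ) : Nat.sqrt (Nat.sqrt n) ^ 4 ≤ n := by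
  have h1 := Nat.sqrt_le' (Nat.sqrt n)
  have h2 := Nat.sqrt_le' n
  calc Nat.sqrt (Nat.sqrt n) ^ 4 = (Nat.sqrt (Nat.sqrt n) ^ 2) ^ 2 := by ring
    _ ≤ Nat.sqrt n ^ 2 := by gcongr
    _ ≤ n := h2

lemma lt_sqrt_sqrt_add_one_pow (n : ℕ) : n < (Nat.sqrt (Nat.sqrt n) + 1) ^ 4 := by
  have h1 := Nat.lt_succ_sqrt' (Nat.sqrt n)
  have h2 := Nat.lt_succ_sqrt' n
  calc n < (Nat.sqrt n + 1) ^ 2 := h2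
    _ ≤ ((Nat.sqrt (Nat.sqrt n) + 1) ^ 2) ^ 2 := by gcongr; exact h1
    _ = _ := by ring

lemma eventually_mul_pow_le {θ : ℝ} (h0 : 0 < θ) (h1 : θ < 1) :
    ∀ᶠ n : ℕ in atTop, n * (3 * θ ^ Nat.sqrt (Nat.sqrt n)) ≤ 1 / 2 := by
  have hlim : Tendsto (fun s : ℕ => 3 / θ * ((((s + 1 : ℕ) : ℝ)) ^ 4 * θ ^ (s + 1))) atTop
      (𝓝 0) := by
    have h := (tendsto_pow_const_mul_const_pow_of_abs_lt_one 4
      (by rwa [abs_of_pos h0] : |θ| < 1)).comp (tendsto_add_atTop_nat 1)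
    simpa using h.const_mul (3 / θ)
  have hev := tendsto_sqrt_sqrt.eventually
    (hlim.eventually_le_const (by norm_num : (0 : ℝ) < 1 / 2))
  filter_upwards [hev] with n hn
  refine le_trans ?_ hn
  have hlt : (n : ℝ) ≤ ((Nat.sqrt (Nat.sqrt n) + 1 : ℕ) : ℝ) ^ 4 := by
    exact_mod_cast (lt_sqrt_sqrt_add_one_pow n).le
  have e : 3 / θ * ((((Nat.sqrt (Nat.sqrt n) + 1 : ℕ) : ℝ)) ^ 4 *
      θ ^ (Nat.sqrt (Nat.sqrt n) + 1)) =
      ((Nat.sqrt (Nat.sqrt n) + 1 : ℕ) : ℝ) ^ 4 * (3 * θ ^ Nat.sqrt (Nat.sqrt n)) := by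
    rw [pow_succ θ]; field_simp
  rw [e]
  gcongr

/-- Comparison of the measure of a cylinder with the supremum of the Birkhoff sum on it. -/
lemma abs_log_measure_cyl_sub_le {b θ C : ℝ} (hb : (b : Torus) ≠ 0) {μ : Measure Torus}
    (hμ : IsGMeasure (b : Torus) μ) (hθ : ∀ x, ac b x ^ 2 * ac b (2 * x) ^ 2 ≤ θ) (hC : 0 ≤ C)
    {n s : ℕ} (hs : 3 ≤ s) (hsn : s ^ 4 ≤ n) (hn : n * (3 * θ ^ s) ≤ 1 / 2)
    (hZ : presZ (b : Torus) (-1) n ≤ ENNReal.ofReal (Real.exp (C * n))) (ω : Fin n → Bool)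
    (hpos : 0 < μ (cyl n ω)) :
    |Real.log (μ (cyl n ω)).toReal - (⨆ x ∈ cyl n ω, psiSum (b : Torus) n x).toReal| ≤
      n * ((21 + 12 * C) / s) := by
  have := hμ.1
  obtain ⟨j, hj, hω⟩ := exists_wordVal_eq n ω
  obtain ⟨x', hx_mem, hmax⟩ := isCompact_Icc.exists_isMaxOn
    (nonempty_Icc.2 (by gcongr; linarith : (j : ℝ) / 2 ^ n ≤ (j + 1) / 2 ^ n))
    (continuous_gprod b n).continuousOn
  have hmax' : ∀ x ∈ Icc ((j : ℝ) / 2 ^ n) ((j + 1) / 2 ^ n), gprod b n x ≤ gprod b n x' :=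
    fun x hx => hmax hx
  have hle := lineMeasure_dyad_le_of_gprod_le hμ hj hmax'
  rw [measure_cyl_eq hb hμ hj hω] at hpos ⊢
  have hx' : 0 < gprod b n x' := ENNReal.ofReal_pos.1 (hpos.trans_le hle)
  have hsup := iSup_psiSum_eq hω hx_mem hx' hmax'
  have hlower := neg_log_le_of_presZ_le hZ hsup
  rw [hsup, EReal.toReal_coe]
  have hpos' : 0 < (lineMeasure μ (dyad n j)).toReal :=
    ENNReal.toReal_pos hpos.ne' (measure_ne_top _ _)
  have hupper : Real.log (lineMeasure μ (dyad n j)).toReal ≤ Real.log (gprod b n x') :=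
    Real.log_le_log hpos' (ENNReal.toReal_le_of_le_ofReal hx'.le hle)
  have hs2 : 3 < s ^ 2 := by nlinarith
  have hκ : (0 : ℝ) < (((s ^ 2 : ℕ) : ℝ) - 3) / 2 := by
    have : ((3 : ℕ) : ℝ) < ((s ^ 2 : ℕ) : ℝ) := Nat.cast_lt.2 hs2
    push_cast at this ⊢
    linarith
  have hmain := le_log_lineMeasure_dyad hμ hθ hj hn hx_mem hx' (log_one_add_pi_mul_le s) hκ
    (five_mul_le_exp hs2.le)
  have herr := error_le (n := n) hC hs hsn
  have hmono : (2 * (s : ℝ) + 3) * (-Real.log (gprod b n x')) / ((((s ^ 2 : ℕ) : ℝ) - 3) / 2) ≤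
      (2 * s + 3) * (C * n) / ((((s ^ 2 : ℕ) : ℝ) - 3) / 2) := by
    gcongr
  rw [abs_le]
  constructor
  · linarith
  · have : (0 : ℝ) ≤ n * ((21 + 12 * C) / s) := by positivity
    linarith

/-- for `c ≠ 0` and a fully supported `g`-measure `μ` for `g^c`, if the
upper topological pressure `P̄_top(t ψ^c)` is finite for every `t ∈ ℝ`, then
`max_{ω ∈ {0,1}ⁿ} |log μ(⟨ω⟩) − sup_{x ∈ ⟨ω⟩} ψ^c_n(x)| ∈ o(n)`. -/
theorem stmt17 (c : Torus) (hc : c ≠ 0) (μ : Measure Torus) (hμ : IsGMeasure c μ)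
    (hpos : ∀ (n : ℕ) (ω : Fin n → Bool), 0 < μ (cyl n ω))
    (hfin : ∀ t : ℝ, presUpper c t ≠ ⊤) :
    Tendsto
      (fun n : ℕ =>
        (n : ℝ)⁻¹ *
          ⨆ ω : Fin n → Bool,
            |Real.log ((μ (cyl n ω)).toReal) - (⨆ x ∈ cyl n ω, psiSum c n x).toReal|)
      atTop (𝓝 0) := by
  obtain ⟨b, rfl⟩ : ∃ b : ℝ, (b : Torus) = c := ⟨rep c, coe_rep c⟩
  obtain ⟨θ, hθ0, hθ1, hθ⟩ := exists_mul_ac_sq_le hc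
  obtain ⟨C, hC, hZ⟩ := exists_presZ_le_exp (hfin (-1))
  have hlim : Tendsto (fun n : ℕ => (21 + 12 * C) / ((Nat.sqrt (Nat.sqrt n) : ℕ) : ℝ)) atTop
      (𝓝 0) :=
    (tendsto_const_div_atTop_nhds_zero_nat _).comp tendsto_sqrt_sqrt
  refine squeeze_zero' (Eventually.of_forall fun n => ?_) ?_ hlim
  · exact mul_nonneg (by positivity) (Real.iSup_nonneg fun _ => abs_nonneg _)
  · filter_upwards [hZ, eventually_mul_pow_le hθ0 hθ1,
      tendsto_sqrt_sqrt.eventually (eventually_ge_atTop 3), eventually_gt_atTop 0]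
      with n hZn hn hs hn0
    rw [inv_mul_le_iff₀ (by exact_mod_cast hn0)]
    exact ciSup_le fun ω => abs_log_measure_cyl_sub_le hc hμ hθ hC hs (sqrt_sqrt_pow_le n) hn hZn
      ω (hpos n ω)

end GTM
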